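/- Let F be the minimal ℤ^n-graded free S-resolution of S/I. Given 1 < i ≤ p and 1 ≤ j ≤ β_i, let k_1,…,k_r be the integers for which λ^{(i)}_{k_t j} ≠ 0. Then x^{a_{ij}} = lcm(x^{a_{i−1,k_1}}, …, x^{a_{i−1,k_r}}). -/

import Mathlib

open MvPolynomial

structure ResData (K : Type) [Field K] (σ : Type) [Fintype σ] [DecidableEq σ] where
  p : ℕ
  β : ℕ → ℕ
  hβ0 : β 0 = 1
  htop : ∀ i, p ≤ i → β (i + 1) = 0
  a : ∀ i, Fin (β i) → σ → ℕ
  ha0 : ∀ j l, a 0 j l = 0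
  lam : ∀ i, Matrix (Fin (β i)) (Fin (β (i + 1))) K
  hmin : ∀ i k j, lam i k j ≠ 0 →
    (∀ l, a i k l ≤ a (i + 1) j l) ∧ a i k ≠ a (i + 1) j

namespace ResData

variable {K : Type} [Field K] {σ : Type} [Fintype σ] [DecidableEq σ]

noncomputable def smat (R : ResData K σ) (i : ℕ) :
    Matrix (Fin (R.β i)) (Fin (R.β (i + 1))) (MvPolynomial σ K) := fun k j =>
  R.lam i k j • monomial (Finsupp.equivFunOnFinite.symm fun l => R.a (i + 1) j l - R.a i k l) 1

def IsMinFreeResOf (R : ResData K σ) (I : Ideal (MvPolynomial σ K)) : Prop :=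
  (∀ i, LinearMap.range (Matrix.mulVecLin (R.smat (i + 1))) =
      LinearMap.ker (Matrix.mulVecLin (R.smat i))) ∧
  ∀ j₀ : Fin (R.β 0),
    Submodule.map (LinearMap.proj j₀) (LinearMap.range (Matrix.mulVecLin (R.smat 0))) = I

/-- Castelnuovo–Mumford regularity of the ideal `I` resolved by `R`,
`reg I = max { |a_{i+1,j}| - i }`, read off from the shifts of the minimal
free resolution of `S/I`. -/
def regIdeal (R : ResData K σ) : ℕ :=
  (Finset.range R.p).sup fun i =>
    Finset.univ.sup fun j : Fin (R.β (i + 1)) => (∑ l, R.a (i + 1) j l) - i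

/-- projective dimension of the module `S/I` resolved by `R`. -/
def pd (R : ResData K σ) : ℕ :=
  ((Finset.range (R.p + 1)).filter fun i => R.β i ≠ 0).sup id

end ResData

/-- `J` is an ideal generated by monomials whose support lies in `s`. -/
def IsMonomialIdealOn {K : Type} [Field K] {σ : Type} (s : Set σ)
    (J : Ideal (MvPolynomial σ K)) : Prop :=
  ∃ A : Set (σ →₀ ℕ), (∀ b ∈ A, (b.support : Set σ) ⊆ s) ∧
    J = Ideal.span ((fun b => (monomial b (1 : K) : MvPolynomial σ K)) '' A)

/-- An ideal generated by monomials. -/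
def IsMonomialIdeal {K : Type} [Field K] {σ : Type} (J : Ideal (MvPolynomial σ K)) : Prop :=
  IsMonomialIdealOn Set.univ J

/-- The ideal `J` has a `d`-linear resolution: in the minimal multigraded free
resolution of `S/J` all shifts in homological degree `i ≥ 1` have total degree
`(i - 1) + d`. -/
def HasLinearRes {K : Type} [Field K] {σ : Type} [Fintype σ] [DecidableEq σ]
    (d : ℕ) (J : Ideal (MvPolynomial σ K)) : Prop :=
  ∃ R : ResData K σ, R.IsMinFreeResOf J ∧
    ∀ i, 1 ≤ i → ∀ j : Fin (R.β i), (∑ l, R.a i j l) = (i - 1) + d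

section Lstar

variable {K : Type} [Field K] {σ : Type} [Fintype σ] [DecidableEq σ]
variable {τ : Type} [Fintype τ] [DecidableEq τ]

/-- The ideals `L_{ij}` of the complex `F*` induced by the resolution data `R`
and the ideals `L_j = Lvec j`:  `Lstar R Lvec 0 j = L_{1j} = L_j` and
`L_{i+1, j} = ⋂ { L_{i,k} : λ^{(i+1)}_{kj} ≠ 0 }` (paper numbering shifted by one). -/
noncomputable def Lstar (R : ResData K σ) (Lvec : Fin (R.β 1) → Ideal (MvPolynomial τ K)) :
    (i : ℕ) → Fin (R.β (i + 1)) → Ideal (MvPolynomial τ K)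
  | 0, j => Lvec j
  | (i + 1), j => ⨅ (k : Fin (R.β (i + 1))) (_ : R.lam (i + 1) k j ≠ 0), Lstar R Lvec i k

/-- The module `F*_i`, realized as a submodule of the free module `T^{β_i}`. -/
noncomputable def FstarSub (R : ResData K σ) (Lvec : Fin (R.β 1) → Ideal (MvPolynomial τ K)) :
    (i : ℕ) → Submodule (MvPolynomial τ K) (Fin (R.β i) → MvPolynomial τ K)
  | 0 => ⊤
  | (i + 1) => Submodule.pi Set.univ fun j => Lstar R Lvec i j

end Lstar

namespace ResData

variable {K : Type} [Field K] {σ : Type} [Fintype σ] [DecidableEq σ]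

lemma constantCoeff_smat (R : ResData K σ) (i : ℕ) (k : Fin (R.β i)) (j : Fin (R.β (i + 1))) :
    constantCoeff (R.smat i k j) = 0 := by
  classical
  by_cases h : R.lam i k j = 0
  · simp [smat, h]
  · obtain ⟨hle, hne⟩ := R.hmin i k j h
    have hexp : Finsupp.equivFunOnFinite.symm (fun l => R.a (i + 1) j l - R.a i k l) ≠ 0 := by
      intro h0
      refine hne (funext fun l => le_antisymm (hle l) ?_)
      have := DFunLike.congr_fun h0 l
      simp only [Finsupp.equivFunOnFinite_symm_apply_apply, Finsupp.coe_zero,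
        Pi.zero_apply] at this
      omega
    simp [smat, constantCoeff_monomial, hexp]

/-- Minimality: every cycle of a minimal resolution has coordinates in the irrelevant ideal. -/
lemma IsMinFreeResOf.constantCoeff_eq_zero_of_mulVec_eq_zero {R : ResData K σ}
    {I : Ideal (MvPolynomial σ K)} (hI : R.IsMinFreeResOf I) {i : ℕ}
    {u : Fin (R.β (i + 1)) → MvPolynomial σ K} (hu : (R.smat i).mulVec u = 0)
    (j : Fin (R.β (i + 1))) : constantCoeff (u j) = 0 := by
  have hmem : u ∈ LinearMap.ker (R.smat i).mulVecLin := by simpa using hu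
  rw [← hI.1 i] at hmem
  obtain ⟨w, rfl⟩ := hmem
  simp [Matrix.mulVec, dotProduct, constantCoeff_smat]

/-- A column of the scalar matrix has a nonzero entry whose shift agrees with the shift of the
column at any prescribed variable. -/
lemma IsMinFreeResOf.exists_lam_ne_zero_le {R : ResData K σ}
    {I : Ideal (MvPolynomial σ K)} (hI : R.IsMinFreeResOf I) (i : ℕ)
    (j : Fin (R.β (i + 2))) (l : σ) :
    ∃ k, R.lam (i + 1) k j ≠ 0 ∧ R.a (i + 2) j l ≤ R.a (i + 1) k l := by
  by_contra! hlt
  have hdvd : ∀ k, X l ∣ R.smat (i + 1) k j := by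
    intro k
    by_cases h : R.lam (i + 1) k j = 0
    · simp [smat, h]
    · have hk : R.a (i + 1) k l < R.a (i + 1 + 1) j l := hlt k h
      rw [smat, smul_eq_C_mul]
      refine Dvd.dvd.mul_left (X_dvd_monomial.mpr (Or.inr ?_)) _
      simp only [Finsupp.equivFunOnFinite_symm_apply_apply]
      omega
  choose v hv using hdvd
  have hcol : (R.smat (i + 1)).mulVec (Pi.single j 1) = (X l : MvPolynomial σ K) • v := by
    ext1 k
    simp [hv]
  have hcycle : v ∈ LinearMap.ker (R.smat i).mulVecLin := by
    have hcomp : (R.smat i).mulVec ((R.smat (i + 1)).mulVec (Pi.single j 1)) = 0 := by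
      have : (R.smat (i + 1)).mulVecLin (Pi.single j 1) ∈
          LinearMap.ker (R.smat i).mulVecLin := by
        rw [← hI.1 i]
        exact LinearMap.mem_range_self _ _
      simpa using this
    rw [hcol, Matrix.mulVec_smul] at hcomp
    simpa using (smul_eq_zero.mp hcomp).resolve_left (X_ne_zero l)
  rw [← hI.1 i] at hcycle
  obtain ⟨w, hw⟩ := hcycle
  have hdiff : (R.smat (i + 1)).mulVec ((X l : MvPolynomial σ K) • w - Pi.single j 1) = 0 := by
    rw [Matrix.mulVec_sub, Matrix.mulVec_smul, hcol, ← hw, Matrix.mulVecLin_apply, sub_self]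
  simpa using hI.constantCoeff_eq_zero_of_mulVec_eq_zero hdiff j

end ResData

/-- **Lemma (shifts).** Let `F` be the minimal multigraded free resolution of `S/I`.
For `1 < i ≤ p` and `j ≤ β_i`, letting `k_1, …, k_r` be the indices with
`λ^{(i)}_{k_t j} ≠ 0`, one has `x^{a_{ij}} = lcm (x^{a_{i-1,k_1}}, …, x^{a_{i-1,k_r}})`;
equivalently, each entry of the exponent vector `a_{ij}` is the maximum of the
corresponding entries of the vectors `a_{i-1,k_t}`.  (Here the paper's level `i`
is `i + 1` below, so `λ^{(i+1)}` is the matrix `R.lam i`.) -/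
theorem shift_eq_lcm_of_nonzero_scalar
    {K : Type} [Field K] {n : ℕ}
    (R : ResData K (Fin n)) (I : Ideal (MvPolynomial (Fin n) K))
    (hI : R.IsMinFreeResOf I) (hInotTop : I ≠ ⊤) :
    ∀ i : ℕ, 1 ≤ i → i + 1 ≤ R.p → ∀ j : Fin (R.β (i + 1)), ∀ l : Fin n,
      R.a (i + 1) j l = ⨆ k : {k : Fin (R.β i) // R.lam i k j ≠ 0}, R.a i k.1 l := by
  intro i hi _ j l
  obtain ⟨i, rfl⟩ := Nat.exists_eq_add_of_le' hi
  obtain ⟨k, hk, hle⟩ := hI.exists_lam_ne_zero_le i j l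
  have : Nonempty {k : Fin (R.β (i + 1)) // R.lam (i + 1) k j ≠ 0} := ⟨⟨k, hk⟩⟩
  exact le_antisymm
    (hle.trans (le_ciSup (f := fun k : {k // R.lam (i + 1) k j ≠ 0} => R.a (i + 1) k.1 l)
      (Set.finite_range _).bddAbove ⟨k, hk⟩))
    (ciSup_le fun k => (R.hmin (i + 1) k.1 j k.2).1 l)
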